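/- arXiv:1709.04858 — 2 statements merged into one kernel-verified Lean document; each statement's English description precedes it below -/
import Mathlib

section
/- Let κ > 0 and let q, q' ∈ ℝ⁴ satisfy ⟨q−q', q−q'⟩ ≤ 0. For each integer s ≥ 1 set m_s := κ/√(s(s+1)) and define the polynomial expression P_s := Σ_{n=0}^{⌊s/2⌋} β^s_n · [(1 − m_s²⟨q,q⟩)(1 − m_s²⟨q',q'⟩)]ⁿ · (1 − m_s²⟨q,q'⟩)^{s−2n}. Then lim_{s→∞} P_s / F_s(1) = J₀(κ·√(−⟨q−q', q−q'⟩)), where F_s(1) = Γ(1+s/2)Γ(1/2+s/2)/Γ(1/2+s). (This is the Pauli–Lubanski limit of the two-point kernel of the rescaled scalar escort fields N₀^{(s,0)}·a^{(s,0)}(e), Proposition 4.3 of the paper.) -/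
noncomputable section

open Filter

/-- Minkowski bilinear form on ℝ⁴. -/
def mink (a b : Fin 4 → ℝ) : ℝ := a 0 * b 0 - a 1 * b 1 - a 2 * b 2 - a 3 * b 3

/-- Pochhammer (rising factorial) symbol `(a)_n`. -/
def poch (a : ℝ) (n : ℕ) : ℝ := ∏ i ∈ Finset.range n, (a + i)

/-- The coefficients `β^s_n`. -/
def beta (s n : ℕ) : ℝ :=
  (1 / (4 ^ n * (Nat.factorial n : ℝ))) *
    ((Nat.factorial s : ℝ) / (Nat.factorial (s - 2 * n) : ℝ)) *
    (1 / poch (1 / 2 - s) n)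

/-- The Bessel function `J₀` of order 0, by its power series. -/
def J0 (u : ℝ) : ℝ := ∑' k : ℕ, (-1) ^ k * (u / 2) ^ (2 * k) / (Nat.factorial k : ℝ) ^ 2

/-- `F_s(1) = Γ(1+s/2)Γ(1/2+s/2)/Γ(1/2+s)`. -/
def Fs1 (s : ℕ) : ℝ :=
  Real.Gamma (1 + (s : ℝ) / 2) * Real.Gamma (1 / 2 + (s : ℝ) / 2) / Real.Gamma (1 / 2 + (s : ℝ))

/-- The polynomial expression `P_s` with `m = κ/√(s(s+1))`. -/
def P (κ : ℝ) (q q' : Fin 4 → ℝ) (s : ℕ) : ℝ :=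
  ∑ n ∈ Finset.range (s / 2 + 1),
    beta s n *
      ((1 - (κ / Real.sqrt ((s : ℝ) * ((s : ℝ) + 1))) ^ 2 * mink q q) *
        (1 - (κ / Real.sqrt ((s : ℝ) * ((s : ℝ) + 1))) ^ 2 * mink q' q')) ^ n *
      (1 - (κ / Real.sqrt ((s : ℝ) * ((s : ℝ) + 1))) ^ 2 * mink q q') ^ (s - 2 * n)

open Polynomial in
/-- Coefficients of `(1 + X) ^ (2 * N) = ((1 + 2 * X) + X ^ 2) ^ N`. -/
theorem choose_two_mul_eq_sum (N M : ℕ) :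
    (2 * N).choose M =
      ∑ j ∈ Finset.range (M / 2 + 1), N.choose j * ((N - j).choose (M - 2 * j) * 2 ^ (M - 2 * j)) := by
  have hpoly : ((1 + X : ℕ[X]) ^ (2 * N)) =
      ∑ j ∈ Finset.range (N + 1), X ^ (2 * j) * (((1 + X : ℕ[X]) ^ (N - j)).comp (C 2 * X)) *
        C (N.choose j) := by
    rw [pow_mul, show (1 + X : ℕ[X]) ^ 2 = X ^ 2 + (1 + C 2 * X) by simp; ring, add_pow]
    simp [pow_mul]
  have hcoeff := congrArg (fun p : ℕ[X] => p.coeff M) hpoly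
  simp only [coeff_one_add_X_pow, finsetSum_coeff, coeff_mul_C, coeff_X_pow_mul',
    comp_C_mul_X_coeff, Nat.cast_id] at hcoeff
  rw [hcoeff]
  have h₁ : ∀ j ∈ Finset.range (N + M + 1), j ∉ Finset.range (N + 1) →
      (if 2 * j ≤ M then (N - j).choose (M - 2 * j) * 2 ^ (M - 2 * j) else 0) * N.choose j = 0 := by
    intro j _ hj
    rw [Nat.choose_eq_zero_of_lt (n := N) (by simp at hj; omega), mul_zero]
  have h₂ : ∀ j ∈ Finset.range (N + M + 1), j ∉ Finset.range (M / 2 + 1) →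
      (if 2 * j ≤ M then (N - j).choose (M - 2 * j) * 2 ^ (M - 2 * j) else 0) * N.choose j = 0 := by
    intro j _ hj
    rw [if_neg (by simp at hj; omega), zero_mul]
  rw [Finset.sum_subset (Finset.range_mono (by omega)) h₁,
    ← Finset.sum_subset (Finset.range_mono (by omega)) h₂]
  refine Finset.sum_congr rfl fun j hj => ?_
  rw [if_pos (by simp at hj; omega), mul_comm]

theorem poch_half_sub (s n : ℕ) (h : n ≤ s) :
    poch (1 / 2 - s) n * (4 ^ n * s.factorial * (2 * (s - n)).factorial) =
      (-1) ^ n * ((2 * s).factorial * (s - n).factorial) := by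
  induction n with
  | zero => simp [poch]; ring
  | succ n ih =>
    obtain ⟨t, rfl⟩ := Nat.exists_eq_add_of_le h
    have ih := ih (by omega)
    rw [show n + 1 + t - n = t + 1 by omega] at ih
    rw [show n + 1 + t - (n + 1) = t by omega]
    simp only [poch, Finset.prod_range_succ] at ih ⊢
    rw [show 2 * (t + 1) = 2 * t + 1 + 1 by ring, Nat.factorial_succ (2 * t + 1),
      Nat.factorial_succ (2 * t), Nat.factorial_succ t] at ih
    push_cast at ih ⊢
    have ht : (t : ℝ) + 1 ≠ 0 := by positivity
    apply mul_left_cancel₀ ht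
    linear_combination (-1) * ih

theorem Fs1_eq (s : ℕ) :
    Fs1 s = 2 ^ s * (s.factorial : ℝ) ^ 2 / (2 * s).factorial := by
  have h₁ := Real.Gamma_mul_Gamma_add_half (1 / 2 + (s : ℝ) / 2)
  have h₂ := Real.Gamma_mul_Gamma_add_half (1 / 2 + (s : ℝ))
  rw [show (1 : ℝ) / 2 + s / 2 + 1 / 2 = 1 + s / 2 by ring,
    show 2 * ((1 : ℝ) / 2 + s / 2) = s + 1 by ring, Real.Gamma_nat_eq_factorial,
    show (1 : ℝ) - (s + 1) = -s by ring, Real.rpow_neg (by norm_num), Real.rpow_natCast] at h₁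
  rw [show (1 : ℝ) / 2 + s + 1 / 2 = s + 1 by ring,
    show 2 * ((1 : ℝ) / 2 + s) = (2 * s : ℕ) + 1 by push_cast; ring, Real.Gamma_nat_eq_factorial,
    Real.Gamma_nat_eq_factorial,
    show (1 : ℝ) - ((2 * s : ℕ) + 1) = -(2 * s : ℕ) by ring, Real.rpow_neg (by norm_num),
    Real.rpow_natCast, pow_mul'] at h₂
  have hΓ : Real.Gamma (1 / 2 + s) ≠ 0 := (Real.Gamma_pos_of_pos (by positivity)).ne'
  have hf : ((2 * s).factorial : ℝ) ≠ 0 := by positivity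
  have h2 : (2 : ℝ) ^ s ≠ 0 := by positivity
  have hs : (s.factorial : ℝ) ≠ 0 := by positivity
  have h₃ : Real.Gamma (1 / 2 + s) =
      (2 * s).factorial * ((2 ^ s) ^ 2)⁻¹ * √Real.pi / s.factorial := by
    rw [← h₂]
    field_simp
  have hπ : √Real.pi ≠ 0 := by positivity
  rw [Fs1, mul_comm (Real.Gamma _), h₁, h₃]
  field_simp

theorem beta_eq_sum (s n : ℕ) (h : 2 * n ≤ s) :
    beta s n = Fs1 s * ∑ j ∈ Finset.range ((s - 2 * n) / 2 + 1),
      (s.descFactorial (2 * (n + j)) : ℝ) / (4 ^ (n + j) * ((n + j).factorial : ℝ) ^ 2) *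
        ((-1) ^ n * (n + j).choose n) := by
  obtain ⟨M, rfl⟩ := Nat.exists_eq_add_of_le h
  have hp := poch_half_sub (2 * n + M) n (by omega)
  have hv := congrArg (Nat.cast (R := ℝ)) (choose_two_mul_eq_sum (n + M) M)
  rw [Nat.cast_choose ℝ (by omega : M ≤ 2 * (n + M))] at hv
  rw [show 2 * n + M - n = n + M by omega] at hp
  rw [show 2 * (n + M) - M = 2 * n + M by omega] at hv
  have hsum : ∑ j ∈ Finset.range ((2 * n + M - 2 * n) / 2 + 1),
      ((2 * n + M).descFactorial (2 * (n + j)) : ℝ) / (4 ^ (n + j) * ((n + j).factorial : ℝ) ^ 2) *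
        ((-1) ^ n * (n + j).choose n) =
      (-1 : ℝ) ^ n * (2 * n + M).factorial /
        (4 ^ n * n.factorial * 2 ^ M * (n + M).factorial) *
        ((2 * (n + M)).factorial / (M.factorial * (2 * n + M).factorial)) := by
    rw [hv, show (2 * n + M - 2 * n) = M by omega]
    push_cast
    rw [Finset.mul_sum]
    refine Finset.sum_congr rfl fun j hj => ?_
    have hj : 2 * j ≤ M := by simp at hj; omega
    obtain ⟨t, rfl⟩ := Nat.exists_eq_add_of_le hj
    have hd := congrArg (Nat.cast (R := ℝ)) (Nat.factorial_mul_descFactorial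
      (show 2 * (n + j) ≤ 2 * n + (2 * j + t) by omega))
    rw [show 2 * n + (2 * j + t) - 2 * (n + j) = t by omega] at hd
    push_cast at hd
    rw [Nat.cast_choose ℝ (by omega : j ≤ n + (2 * j + t)),
      Nat.cast_choose ℝ (by omega : 2 * j + t - 2 * j ≤ n + (2 * j + t) - j),
      Nat.cast_choose ℝ (by omega : n ≤ n + j),
      show 2 * j + t - 2 * j = t by omega, show n + (2 * j + t) - j = n + j + t by omega,
      show n + j + t - t = n + j by omega, show n + j - n = j by omega, ← hd,
      pow_add 2 (2 * j) t, pow_mul]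
    field_simp
    ring
  rw [hsum, Fs1_eq, beta, show 2 * n + M - 2 * n = M by omega]
  have hne : poch (1 / 2 - (2 * n + M : ℕ)) n ≠ 0 := by
    intro h0
    rw [h0, zero_mul] at hp
    have : ((-1 : ℝ)) ^ n * ((2 * (2 * n + M)).factorial * (n + M).factorial) ≠ 0 := by positivity
    exact this hp.symm
  have hpe : poch (1 / 2 - (2 * n + M : ℕ)) n = (-1) ^ n * ((2 * (2 * n + M)).factorial *
      (n + M).factorial) / (4 ^ n * (2 * n + M).factorial * (2 * (n + M)).factorial) := by
    rw [← hp]; field_simp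
  rw [hpe, pow_add, pow_mul]
  field_simp
  norm_num
  exact neg_one_pow_eq_or ℝ n

/-- Laplace-type expansion of the homogenised Legendre polynomial. -/
theorem sum_beta_eq (s : ℕ) (A B : ℝ) :
    ∑ n ∈ Finset.range (s / 2 + 1), beta s n * A ^ n * B ^ (s - 2 * n) =
      Fs1 s * ∑ k ∈ Finset.range (s / 2 + 1),
        (s.descFactorial (2 * k) : ℝ) / (4 ^ k * (k.factorial : ℝ) ^ 2) *
          B ^ (s - 2 * k) * (B ^ 2 - A) ^ k := by
  have hexp : ∀ k ∈ Finset.range (s / 2 + 1),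
      (s.descFactorial (2 * k) : ℝ) / (4 ^ k * (k.factorial : ℝ) ^ 2) *
          B ^ (s - 2 * k) * (B ^ 2 - A) ^ k =
      ∑ n ∈ Finset.range (k + 1), (s.descFactorial (2 * k) : ℝ) /
        (4 ^ k * (k.factorial : ℝ) ^ 2) * ((-1) ^ n * k.choose n) * (A ^ n * B ^ (s - 2 * n)) := by
    intro k hk
    rw [show B ^ 2 - A = -A + B ^ 2 by ring, add_pow, Finset.mul_sum]
    refine Finset.sum_congr rfl fun n hn => ?_
    simp only [Finset.mem_range] at hk hn
    rw [show s - 2 * n = (s - 2 * k) + 2 * (k - n) by omega, pow_add, pow_mul, neg_pow A]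
    ring
  rw [Finset.sum_congr rfl hexp, Finset.sum_comm' (t' := Finset.range (s / 2 + 1))
    (s' := fun n => Finset.Ico n (s / 2 + 1)) (by intro k n; simp; omega), Finset.mul_sum]
  refine Finset.sum_congr rfl fun n hn => ?_
  simp only [Finset.mem_range] at hn
  rw [Finset.sum_Ico_eq_sum_range, ← Finset.sum_mul, ← mul_assoc, mul_assoc (beta s n),
    beta_eq_sum s n (by omega), show (s - 2 * n) / 2 + 1 = s / 2 + 1 - n by omega]

theorem tendsto_sum_bessel {B D : ℕ → ℝ} {L : ℝ}
    (hB : Tendsto (fun s : ℕ => (s : ℝ) * (B s - 1)) atTop (nhds 0))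
    (hD : Tendsto (fun s : ℕ => (s : ℝ) ^ 2 * D s) atTop (nhds L)) :
    Tendsto (fun s : ℕ => ∑ k ∈ Finset.range (s / 2 + 1),
        (s.descFactorial (2 * k) : ℝ) / (4 ^ k * (k.factorial : ℝ) ^ 2) *
          B s ^ (s - 2 * k) * D s ^ k) atTop
      (nhds (∑' k : ℕ, L ^ k / (4 ^ k * (k.factorial : ℝ) ^ 2))) := by
  have hsum (s : ℕ) : ∑ k ∈ Finset.range (s / 2 + 1),
        (s.descFactorial (2 * k) : ℝ) / (4 ^ k * (k.factorial : ℝ) ^ 2) *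
          B s ^ (s - 2 * k) * D s ^ k = ∑' k : ℕ,
        (s.descFactorial (2 * k) : ℝ) / (4 ^ k * (k.factorial : ℝ) ^ 2) *
          B s ^ (s - 2 * k) * D s ^ k := by
    refine (tsum_eq_sum fun k hk => ?_).symm
    rw [Nat.descFactorial_of_lt (by simp at hk; omega)]
    simp
  simp only [hsum]
  have hB0 : Tendsto (fun s : ℕ => B s - 1) atTop (nhds 0) := by
    have := hB.mul (tendsto_inv_atTop_nhds_zero_nat (𝕜 := ℝ))
    rw [zero_mul] at this
    refine this.congr' ?_
    filter_upwards [eventually_gt_atTop 0] with s hs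
    have : (s : ℝ) ≠ 0 := by positivity
    field_simp
  have hB1 : Tendsto B atTop (nhds 1) := by simpa using hB0.add_const 1
  have hBs : Tendsto (fun s => B s ^ s) atTop (nhds 1) := by
    simpa using Real.tendsto_one_add_pow_exp_of_tendsto hB
  have hdesc (m : ℕ) :
      Tendsto (fun s : ℕ => (s.descFactorial m : ℝ) / (s : ℝ) ^ m) atTop (nhds 1) := by
    refine (Asymptotics.isEquivalent_iff_tendsto_one ?_).1 (isEquivalent_descFactorial m)
    filter_upwards [eventually_gt_atTop 0] with s hs
    positivity
  refine tendsto_tsum_of_dominated_convergence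
    (bound := fun k => Real.exp 1 * ((|L| + 1) ^ k / k.factorial))
    ((Real.summable_pow_div_factorial _).mul_left _) (fun k => ?_) ?_
  · have hpow : Tendsto (fun s => B s ^ (s - 2 * k)) atTop (nhds 1) := by
      have := hBs.div (hB1.pow (2 * k)) (by simp)
      simp only [one_pow, div_one] at this
      refine this.congr' ?_
      filter_upwards [eventually_ge_atTop (2 * k), hB1.eventually_ne one_ne_zero] with s hs hne
      simp only [Pi.div_apply]
      rw [div_eq_iff (pow_ne_zero _ hne), ← pow_add, Nat.sub_add_cancel hs]
    have := (((hdesc (2 * k)).mul hpow).mul (hD.pow k)).div_const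
      (4 ^ k * (k.factorial : ℝ) ^ 2)
    simp only [one_mul] at this
    refine this.congr' ?_
    filter_upwards [eventually_gt_atTop 0] with s hs
    have : (s : ℝ) ≠ 0 := by positivity
    rw [mul_pow, ← pow_mul]
    field_simp
  · have hB' : ∀ᶠ s : ℕ in atTop, |(s : ℝ) * (B s - 1)| ≤ 1 :=
      (hB.abs.eventually_le_const (by simp))
    have hD' : ∀ᶠ s : ℕ in atTop, |(s : ℝ) ^ 2 * D s| ≤ |L| + 1 :=
      (hD.abs.eventually_le_const (by simp))
    filter_upwards [hB', hD'] with s h₁ h₂ k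
    have hBk : |B s| ^ (s - 2 * k) ≤ Real.exp 1 := calc
      |B s| ^ (s - 2 * k) ≤ (Real.exp |B s - 1|) ^ (s - 2 * k) := by
        refine pow_le_pow_left₀ (abs_nonneg _) ?_ _
        have := abs_add_le (B s - 1) 1
        rw [sub_add_cancel, abs_one] at this
        exact this.trans (Real.add_one_le_exp _)
      _ ≤ (Real.exp |B s - 1|) ^ s :=
        pow_le_pow_right₀ (Real.one_le_exp (abs_nonneg _)) (Nat.sub_le _ _)
      _ ≤ Real.exp 1 := by
        rw [← Real.exp_nat_mul]
        rw [abs_mul, Nat.abs_cast] at h₁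
        exact Real.exp_le_exp.2 h₁
    have hdf : (s.descFactorial (2 * k) : ℝ) ≤ (s : ℝ) ^ (2 * k) := by
      exact_mod_cast Nat.descFactorial_le_pow s (2 * k)
    have hDk : (s.descFactorial (2 * k) : ℝ) * |D s| ^ k ≤ (|L| + 1) ^ k := calc
      _ ≤ (s : ℝ) ^ (2 * k) * |D s| ^ k := by gcongr
      _ = |(s : ℝ) ^ 2 * D s| ^ k := by
        rw [abs_mul, mul_pow, abs_of_nonneg (by positivity : (0 : ℝ) ≤ (s : ℝ) ^ 2), ← pow_mul]
      _ ≤ _ := pow_le_pow_left₀ (abs_nonneg _) h₂ _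
    have hk : (k.factorial : ℝ) ≤ 4 ^ k * (k.factorial : ℝ) ^ 2 := by
      have h4 : (1 : ℝ) ≤ 4 ^ k := one_le_pow₀ (by norm_num)
      have hf : (1 : ℝ) ≤ k.factorial := by exact_mod_cast k.factorial_pos
      nlinarith [mul_le_mul h4 hf zero_le_one (by positivity)]
    rw [Real.norm_eq_abs, abs_mul, abs_mul, abs_div, Nat.abs_cast, abs_pow, abs_pow,
      abs_of_pos (by positivity : (0 : ℝ) < 4 ^ k * (k.factorial : ℝ) ^ 2)]
    calc _ = |B s| ^ (s - 2 * k) * ((s.descFactorial (2 * k) : ℝ) * |D s| ^ k /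
          (4 ^ k * (k.factorial : ℝ) ^ 2)) := by ring
      _ ≤ _ := by gcongr

/-- Proposition 4.3: the Pauli–Lubanski limit of the two-point kernel of the rescaled
scalar escort fields. -/
theorem pauli_lubanski_limit_scalar_escort (κ : ℝ) (hκ : 0 < κ) (q q' : Fin 4 → ℝ)
    (hqq' : mink (q - q') (q - q') ≤ 0) :
    Tendsto (fun s : ℕ => P κ q q' s / Fs1 s) atTop
      (nhds (J0 (κ * Real.sqrt (-mink (q - q') (q - q'))))) := by
  set x : ℕ → ℝ := fun s => (κ / √((s : ℝ) * ((s : ℝ) + 1))) ^ 2 with hx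
  have hxs (s : ℕ) : x s = κ ^ 2 / ((s : ℝ) * ((s : ℝ) + 1)) := by
    simp only [hx]
    rw [div_pow, Real.sq_sqrt (by positivity)]
  have hinv := tendsto_inv_atTop_nhds_zero_nat (𝕜 := ℝ)
  have hx2 : Tendsto (fun s : ℕ => (s : ℝ) ^ 2 * x s) atTop (nhds (κ ^ 2)) := by
    have := ((hinv.const_add 1).inv₀ (by norm_num)).const_mul (κ ^ 2)
    simp only [add_zero, inv_one, mul_one] at this
    refine this.congr' ?_
    filter_upwards [eventually_gt_atTop 0] with s hs
    have : (s : ℝ) ≠ 0 := by positivity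
    rw [hxs]
    field_simp
  have hx1 : Tendsto (fun s : ℕ => (s : ℝ) * x s) atTop (nhds 0) := by
    have := hx2.mul hinv
    rw [mul_zero] at this
    refine this.congr' ?_
    filter_upwards [eventually_gt_atTop 0] with s hs
    have : (s : ℝ) ≠ 0 := by positivity
    field_simp
  have hx0 : Tendsto x atTop (nhds 0) := by
    have := hx1.mul hinv
    rw [mul_zero] at this
    refine this.congr' ?_
    filter_upwards [eventually_gt_atTop 0] with s hs
    have : (s : ℝ) ≠ 0 := by positivity
    field_simp
  have hB : Tendsto (fun s : ℕ => (s : ℝ) * ((1 - x s * mink q q') - 1)) atTop (nhds 0) := by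
    have := hx1.mul_const (-mink q q')
    rw [zero_mul] at this
    exact this.congr fun s => by ring
  have hD : Tendsto (fun s : ℕ => (s : ℝ) ^ 2 * ((1 - x s * mink q q') ^ 2 -
      (1 - x s * mink q q) * (1 - x s * mink q' q'))) atTop
      (nhds (κ ^ 2 * mink (q - q') (q - q'))) := by
    have := hx2.mul ((hx0.mul_const (mink q q' ^ 2 - mink q q * mink q' q')).const_add
      (mink (q - q') (q - q')))
    rw [zero_mul, add_zero] at this
    refine this.congr fun s => ?_
    have hpol : mink (q - q') (q - q') = mink q q + mink q' q' - 2 * mink q q' := by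
      simp only [mink, Pi.sub_apply]
      ring
    rw [hpol]
    ring
  have hJ : J0 (κ * √(-mink (q - q') (q - q'))) =
      ∑' k : ℕ, (κ ^ 2 * mink (q - q') (q - q')) ^ k / (4 ^ k * (k.factorial : ℝ) ^ 2) := by
    refine tsum_congr fun k => ?_
    rw [pow_mul, div_pow, mul_pow, Real.sq_sqrt (by linarith), ← mul_pow, ← div_div, ← div_pow]
    congr 2
    ring
  rw [hJ]
  refine (tendsto_sum_bessel hB hD).congr fun s => ?_
  have hF : Fs1 s ≠ 0 := by
    rw [Fs1_eq]
    positivity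
  rw [eq_div_iff hF, mul_comm, ← sum_beta_eq]
  rfl
end
end

section
/- For every u ∈ ℝ, lim_{s→∞} G_s(−u²/s²) = J₀(u), i.e. lim_{s→∞} Σ_{k=0}^{⌊s/2⌋} ((−s/2)_k ((1−s)/2)_k / (k!)²) · (−u²/s²)^k = Σ_{k=0}^∞ (−1)^k (u/2)^{2k}/(k!)². (Lemma 4.2: the pointwise limit of the terminating hypergeometric series ₂F₁(−s/2,(1−s)/2;1;−u²/s²) is the Bessel function J₀.) -/
noncomputable section

open Filter

/-- `G_s(w) = Σ_{k=0}^{⌊s/2⌋} ((−s/2)_k ((1−s)/2)_k /(k!)²) w^k = ₂F₁(−s/2,(1−s)/2;1;w)`. -/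
def G (s : ℕ) (w : ℝ) : ℝ :=
  ∑ k ∈ Finset.range (s / 2 + 1),
    poch (-(s : ℝ) / 2) k * poch ((1 - (s : ℝ)) / 2) k / (Nat.factorial k : ℝ) ^ 2 * w ^ k

/-- A Pochhammer symbol with upper parameter in `[-x, 1 - k + x]` has absolute value at most
`x ^ k`. -/
theorem abs_poch_le {a x : ℝ} {k : ℕ} (ha : -x ≤ a) (hk : a + k ≤ x + 1) :
    |poch a k| ≤ x ^ k := by
  rw [poch, Finset.abs_prod]
  calc ∏ i ∈ Finset.range k, |a + i| ≤ ∏ _i ∈ Finset.range k, x := by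
        refine Finset.prod_le_prod (fun _ _ => abs_nonneg _) fun i hi => ?_
        have hik : (i : ℝ) + 1 ≤ k := by exact_mod_cast Finset.mem_range.mp hi
        have hi0 : (0 : ℝ) ≤ i := i.cast_nonneg
        exact abs_le.mpr ⟨by linarith, by linarith⟩
    _ = x ^ k := by simp

/-- If `a s ~ c s`, then `(a s)_k / s ^ k` tends to `c ^ k`. -/
theorem tendsto_poch_div_pow {a : ℕ → ℝ} {c : ℝ}
    (h : Tendsto (fun s : ℕ => a s / (s : ℝ)) atTop (nhds c)) (k : ℕ) :
    Tendsto (fun s : ℕ => poch (a s) k / (s : ℝ) ^ k) atTop (nhds (c ^ k)) := by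
  have key : Tendsto (fun s : ℕ => ∏ i ∈ Finset.range k, (a s / (s : ℝ) + (i : ℝ) / (s : ℝ)))
      atTop (nhds (∏ _i ∈ Finset.range k, (c + 0))) :=
    tendsto_finsetProd _ fun i _ => h.add (tendsto_const_div_atTop_nhds_zero_nat (i : ℝ))
  simpa [poch, ← add_div, Finset.prod_div_distrib] using key

/-- The `k`-th term of `G s (-u² / s²)`, with the powers of `s` absorbed into the Pochhammer
symbols. -/
theorem G_term_eq (u : ℝ) (s k : ℕ) :
    poch (-(s : ℝ) / 2) k * poch ((1 - (s : ℝ)) / 2) k / (Nat.factorial k : ℝ) ^ 2 *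
        (-u ^ 2 / (s : ℝ) ^ 2) ^ k =
      (poch (-(s : ℝ) / 2) k / (s : ℝ) ^ k) * (poch ((1 - (s : ℝ)) / 2) k / (s : ℝ) ^ k) *
        ((-u ^ 2) ^ k / (Nat.factorial k : ℝ) ^ 2) := by
  rw [div_pow, ← pow_mul, mul_comm 2 k, pow_mul]
  simp only [div_eq_mul_inv, mul_inv, sq ((s : ℝ) ^ k)]
  ring

theorem tendsto_G_term (u : ℝ) (k : ℕ) :
    Tendsto (fun s : ℕ => poch (-(s : ℝ) / 2) k * poch ((1 - (s : ℝ)) / 2) k /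
        (Nat.factorial k : ℝ) ^ 2 * (-u ^ 2 / (s : ℝ) ^ 2) ^ k) atTop
      (nhds ((-1) ^ k * (u / 2) ^ (2 * k) / (Nat.factorial k : ℝ) ^ 2)) := by
  simp only [G_term_eq]
  have ha : Tendsto (fun s : ℕ => -(s : ℝ) / 2 / (s : ℝ)) atTop (nhds (-1 / 2)) := by
    refine tendsto_const_nhds.congr' ?_
    filter_upwards [eventually_ne_atTop 0] with s hs
    field_simp
  have hb : Tendsto (fun s : ℕ => (1 - (s : ℝ)) / 2 / (s : ℝ)) atTop (nhds (-1 / 2)) := by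
    have h := (tendsto_const_div_atTop_nhds_zero_nat (1 / 2 : ℝ)).add ha
    rw [zero_add] at h
    refine h.congr fun s => ?_
    ring
  convert ((tendsto_poch_div_pow ha k).mul (tendsto_poch_div_pow hb k)).mul_const
    ((-u ^ 2) ^ k / (Nat.factorial k : ℝ) ^ 2) using 2
  rw [← mul_div_assoc, ← mul_pow, ← mul_pow, pow_mul, ← mul_pow]
  ring

theorem abs_G_term_le (u : ℝ) {s k : ℕ} (hk : k ≤ s / 2) :
    |poch (-(s : ℝ) / 2) k * poch ((1 - (s : ℝ)) / 2) k / (Nat.factorial k : ℝ) ^ 2 *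
        (-u ^ 2 / (s : ℝ) ^ 2) ^ k| ≤ (u ^ 2 / 4) ^ k / (Nat.factorial k : ℝ) := by
  have hks : (k : ℝ) ≤ s / 2 := by
    have : ((2 * k : ℕ) : ℝ) ≤ s := by exact_mod_cast (by omega : 2 * k ≤ s)
    push_cast at this
    linarith
  have hs0 : (0 : ℝ) ≤ s := s.cast_nonneg
  have ratio_le {a : ℝ} (h : |poch a k| ≤ ((s : ℝ) / 2) ^ k) :
      |poch a k / (s : ℝ) ^ k| ≤ (1 / 2) ^ k := by
    rw [abs_div, abs_of_nonneg (pow_nonneg hs0 k)]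
    refine div_le_of_le_mul₀ (by positivity) (by positivity) (h.trans_eq ?_)
    rw [← mul_pow]
    ring
  have ha := ratio_le (abs_poch_le (a := -(s : ℝ) / 2) (by linarith) (by linarith))
  have hb := ratio_le (abs_poch_le (a := (1 - (s : ℝ)) / 2) (by linarith) (by linarith))
  have hf : (1 : ℝ) ≤ Nat.factorial k := by exact_mod_cast k.factorial_pos
  have hc : |(-u ^ 2) ^ k / (Nat.factorial k : ℝ) ^ 2| ≤ (u ^ 2) ^ k / (Nat.factorial k : ℝ) := by
    rw [abs_div, abs_pow, abs_neg, abs_of_nonneg (sq_nonneg u),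
      abs_of_nonneg (sq_nonneg (Nat.factorial k : ℝ))]
    gcongr
    exact le_self_pow₀ hf two_ne_zero
  rw [G_term_eq, abs_mul, abs_mul]
  calc _ ≤ (1 / 2 : ℝ) ^ k * (1 / 2) ^ k * ((u ^ 2) ^ k / (Nat.factorial k : ℝ)) := by gcongr
    _ = (u ^ 2 / 4) ^ k / (Nat.factorial k : ℝ) := by
      rw [← mul_div_assoc, ← mul_pow, ← mul_pow]
      ring

/-- Lemma 4.2: the pointwise limit of `₂F₁(−s/2,(1−s)/2;1;−u²/s²)` is `J₀(u)`. -/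
theorem hypergeometric_tendsto_besselJ0 (u : ℝ) :
    Tendsto (fun s : ℕ => G s (-u ^ 2 / (s : ℝ) ^ 2)) atTop (nhds (J0 u)) := by
  have hG (s : ℕ) : G s (-u ^ 2 / (s : ℝ) ^ 2) = ∑' k : ℕ,
      (Finset.range (s / 2 + 1) : Set ℕ).indicator (fun k => poch (-(s : ℝ) / 2) k *
        poch ((1 - (s : ℝ)) / 2) k / (Nat.factorial k : ℝ) ^ 2 * (-u ^ 2 / (s : ℝ) ^ 2) ^ k) k := by
    rw [G, sum_eq_tsum_indicator]
  simp only [hG, J0]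
  refine tendsto_tsum_of_dominated_convergence
    (bound := fun k => (u ^ 2 / 4) ^ k / (Nat.factorial k : ℝ))
    (Real.summable_pow_div_factorial _) (fun k => ?_) (.of_forall fun s k => ?_)
  · refine (tendsto_G_term u k).congr' ?_
    filter_upwards [eventually_ge_atTop (2 * k)] with s hs
    rw [Set.indicator_of_mem]
    simp only [Finset.coe_range, Set.mem_Iio]
    omega
  · by_cases hk : k ∈ (Finset.range (s / 2 + 1) : Set ℕ)
    · rw [Set.indicator_of_mem hk, Real.norm_eq_abs]
      simp only [Finset.coe_range, Set.mem_Iio] at hk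
      exact abs_G_term_le u (by omega)
    · rw [Set.indicator_of_notMem hk, norm_zero]
      positivity
end
end
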